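/- Let C be a skeletally small triangulated category and let H be a Q-subspace of G(C)_Q. If D₁ and D₂ are two radical dense subcategories of C with H = image(δ^{D₁}_Q) = image(δ^{D₂}_Q), then D₁ = D₂. Thus there is a unique radical dense subcategory D_H of C with image(δ^{D_H}_Q) = H. -/

import Mathlib

open CategoryTheory CategoryTheory.Limits CategoryTheory.Pretriangulated
open scoped TensorProduct

universe v u

set_option linter.unusedSectionVars false
set_option linter.unusedVariables false

namespace GrothendieckPaper

variable (C : Type u) [Category.{v} C] [Preadditive C] [Limits.HasZeroObject C]
  [HasShift C ℤ] [∀ n : ℤ, (shiftFunctor C n).Additive] [Pretriangulated C]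

/-- The set of Euler relations `[V] - [U] - [W]` coming from distinguished triangles
`U ⟶ V ⟶ W ⟶ U⟦1⟧`. -/
def eulerSet : Set (FreeAbelianGroup C) :=
  { x | ∃ T : Triangle C, (T ∈ distTriang C) ∧
      x = FreeAbelianGroup.of T.obj₂ - FreeAbelianGroup.of T.obj₁ - FreeAbelianGroup.of T.obj₃ }

def eulerSubgroup : AddSubgroup (FreeAbelianGroup C) := AddSubgroup.closure (eulerSet C)

/-- The Grothendieck group of a (skeletally small) triangulated category. -/
def G : Type u := FreeAbelianGroup C ⧸ eulerSubgroup C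

instance : AddCommGroup (G C) := QuotientAddGroup.Quotient.addCommGroup _

/-- The class `[U]` of an object `U` in the Grothendieck group. -/
def cls (U : C) : G C := QuotientAddGroup.mk (FreeAbelianGroup.of U)

/-- A (strictly full) triangulated subcategory of `C`, given by its set of objects:
closed under isomorphisms, under the shifts `[1]` and `[-1]`, and under extensions
(cones): if `X ⟶ Y ⟶ Z ⟶ X⟦1⟧` is distinguished and `X, Y` belong then so does `Z`. -/
structure IsTriangulatedSubcat (S : Set C) : Prop where
  mem_of_iso : ∀ {X Y : C}, (X ≅ Y) → Y ∈ S → X ∈ S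
  shift_mem : ∀ {X : C}, X ∈ S → ((shiftFunctor C (1 : ℤ)).obj X) ∈ S
  shift_neg_mem : ∀ {X : C}, X ∈ S → ((shiftFunctor C (-1 : ℤ)).obj X) ∈ S
  ext_mem : ∀ (T : Triangle C), (T ∈ distTriang C) → T.obj₁ ∈ S → T.obj₂ ∈ S → T.obj₃ ∈ S

/-- `npowAux U n` is the direct sum of `n + 1` copies of `U`. -/
noncomputable def npowAux (U : C) : ℕ → C
  | 0 => U
  | n + 1 => U ⊞ npowAux U n

/-- `npow U n` is the direct sum `U^n` of `n` copies of `U` (for `n ≥ 1`;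
`npow U 0` is defined to be `U` as a junk value). -/
noncomputable def npow (U : C) (n : ℕ) : C := npowAux C U (n - 1)

/-- A subcategory (set of objects) `S` is dense in `C` if every object of `C` is a
direct summand of an object of `S`. -/
def DenseSub (S : Set C) : Prop := ∀ U : C, ∃ V : C, (U ⊞ V) ∈ S

/-- A subcategory `S` is radical if `U^n ∈ S` for some `n ≥ 1` implies `U ∈ S`. -/
def RadicalSub (S : Set C) : Prop := ∀ (U : C) (n : ℕ), 1 ≤ n → npow C U n ∈ S → U ∈ S

/-- `√S = { U | U^n ∈ S for some n ≥ 1 }`. -/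
def sqrtSet (S : Set C) : Set C := { U : C | ∃ n : ℕ, 1 ≤ n ∧ npow C U n ∈ S }

lemma subset_sqrtSet (S : Set C) : S ⊆ sqrtSet C S := fun U hU => ⟨1, le_refl 1, hU⟩

/-- The Euler relations for the full subcategory on `S`, coming from distinguished
triangles of `C` all of whose vertices lie in `S`. -/
def eulerSetSub (S : Set C) : Set (FreeAbelianGroup S) :=
  { x | ∃ (T : Triangle C) (_ : T ∈ distTriang C) (h1 : T.obj₁ ∈ S) (h2 : T.obj₂ ∈ S)
      (h3 : T.obj₃ ∈ S),
      x = FreeAbelianGroup.of (⟨T.obj₂, h2⟩ : S) - FreeAbelianGroup.of ⟨T.obj₁, h1⟩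
        - FreeAbelianGroup.of ⟨T.obj₃, h3⟩ }

/-- The Grothendieck group of the triangulated subcategory on the set of objects `S`. -/
def GSub (S : Set C) : Type u := FreeAbelianGroup S ⧸ AddSubgroup.closure (eulerSetSub C S)

instance (S : Set C) : AddCommGroup (GSub C S) := QuotientAddGroup.Quotient.addCommGroup _

lemma delta_le (S : Set C) :
    AddSubgroup.closure (eulerSetSub C S) ≤
      (eulerSubgroup C).comap (FreeAbelianGroup.map (Subtype.val : S → C)) := by
  rw [AddSubgroup.closure_le]
  rintro x ⟨T, hT, h1, h2, h3, rfl⟩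
  simp only [SetLike.mem_coe, AddSubgroup.mem_comap, map_sub, FreeAbelianGroup.map_of_apply]
  exact AddSubgroup.subset_closure ⟨T, hT, rfl⟩

/-- The natural map `δ^S : G(S) → G(C)` induced by the inclusion of the subcategory. -/
def deltaHom (S : Set C) : GSub C S →+ G C :=
  QuotientAddGroup.map _ _ (FreeAbelianGroup.map (Subtype.val : S → C)) (delta_le C S)

lemma incl_le {S S' : Set C} (h : S ⊆ S') :
    AddSubgroup.closure (eulerSetSub C S) ≤
      (AddSubgroup.closure (eulerSetSub C S')).comap
        (FreeAbelianGroup.map (Set.inclusion h)) := by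
  rw [AddSubgroup.closure_le]
  rintro x ⟨T, hT, h1, h2, h3, rfl⟩
  simp only [SetLike.mem_coe, AddSubgroup.mem_comap, map_sub, FreeAbelianGroup.map_of_apply]
  exact AddSubgroup.subset_closure ⟨T, hT, h h1, h h2, h h3, rfl⟩

/-- The map `G(S) → G(S')` induced by an inclusion `S ⊆ S'` of subcategories. -/
def inclHom {S S' : Set C} (h : S ⊆ S') : GSub C S →+ GSub C S' :=
  QuotientAddGroup.map _ _ (FreeAbelianGroup.map (Set.inclusion h)) (incl_le C h)

/-- `δ^S ⊗ ℚ : G(S)_ℚ → G(C)_ℚ`. -/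
noncomputable def deltaQ (S : Set C) : ℚ ⊗[ℤ] GSub C S →ₗ[ℚ] ℚ ⊗[ℤ] G C :=
  LinearMap.baseChange ℚ (deltaHom C S).toIntLinearMap

/-- The rationalization of the map induced by an inclusion of subcategories. -/
noncomputable def inclQ {S S' : Set C} (h : S ⊆ S') :
    ℚ ⊗[ℤ] GSub C S →ₗ[ℚ] ℚ ⊗[ℤ] GSub C S' :=
  LinearMap.baseChange ℚ (inclHom C h).toIntLinearMap

/-- The collection `I(H)` of dense triangulated subcategories `S` of `C` with
`image(δ^S_ℚ) = H`. -/
def denseFamily (H : Submodule ℚ (ℚ ⊗[ℤ] G C)) : Set (Set C) :=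
  { S | IsTriangulatedSubcat C S ∧ DenseSub C S ∧ LinearMap.range (deltaQ C S) = H }


variable {C}

/-- The termwise direct sum of two distinguished triangles, up to isomorphism of the vertices. -/
lemma exists_distTriang_biprod {T T' : Triangle C} (hT : T ∈ distTriang C)
    (hT' : T' ∈ distTriang C) :
    ∃ T'' ∈ distTriang C, Nonempty (T.obj₁ ⊞ T'.obj₁ ≅ T''.obj₁) ∧
      Nonempty (T.obj₂ ⊞ T'.obj₂ ≅ T''.obj₂) ∧ Nonempty (T.obj₃ ⊞ T'.obj₃ ≅ T''.obj₃) := by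
  let F : WalkingPair → Triangle C := fun j => WalkingPair.casesOn j T T'
  have hF : ∀ j, F j ∈ distTriang C := by
    rintro (_ | _)
    exacts [hT, hT']
  have iso (f : WalkingPair → C) : Nonempty (f .left ⊞ f .right ≅ ∏ᶜ f) :=
    ⟨biprod.isoProd _ _ ≪≫
      HasLimit.isoOfNatIso (diagramIsoPair (Discrete.functor f)).symm⟩
  exact ⟨productTriangle F, productTriangle_distinguished F hF,
    iso fun j => (F j).obj₁, iso fun j => (F j).obj₂, iso fun j => (F j).obj₃⟩

lemma cls_obj₂ {T : Triangle C} (hT : T ∈ distTriang C) :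
    cls C T.obj₂ = cls C T.obj₁ + cls C T.obj₃ := by
  have h : (QuotientAddGroup.mk' (eulerSubgroup C)) (FreeAbelianGroup.of T.obj₂ -
      FreeAbelianGroup.of T.obj₁ - FreeAbelianGroup.of T.obj₃) = 0 :=
    (QuotientAddGroup.eq_zero_iff _).2 (AddSubgroup.subset_closure ⟨T, hT, rfl⟩)
  rw [map_sub, map_sub, sub_sub, sub_eq_zero] at h
  exact h

lemma cls_npowAux (U : C) (n : ℕ) : cls C (npowAux C U n) = (n + 1) • cls C U := by
  induction n with
  | zero => simp [npowAux]
  | succ n ih =>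
    have h := cls_obj₂ (binaryBiproductTriangle_distinguished U (npowAux C U n))
    rw [succ_nsmul', ← ih]
    exact h

lemma cls_npow (U : C) {n : ℕ} (hn : 1 ≤ n) : cls C (npow C U n) = n • cls C U := by
  rw [npow, cls_npowAux, Nat.sub_add_cancel hn]

namespace IsTriangulatedSubcat

variable {S : Set C}

lemma mem_iff_of_iso (h : IsTriangulatedSubcat C S) {X Y : C} (e : X ≅ Y) : X ∈ S ↔ Y ∈ S :=
  ⟨h.mem_of_iso e.symm, h.mem_of_iso e⟩

lemma obj₂_mem (h : IsTriangulatedSubcat C S) {T : Triangle C} (hT : T ∈ distTriang C)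
    (h₁ : T.obj₁ ∈ S) (h₃ : T.obj₃ ∈ S) : T.obj₂ ∈ S :=
  h.ext_mem _ (inv_rot_of_distTriang T hT) (h.shift_neg_mem h₃) h₁

lemma biprod_mem_iff (h : IsTriangulatedSubcat C S) {A : C} (hA : A ∈ S) (X : C) :
    (A ⊞ X) ∈ S ↔ X ∈ S :=
  ⟨fun hX => h.ext_mem _ (binaryBiproductTriangle_distinguished A X) hA hX,
    fun hX => h.obj₂_mem (binaryBiproductTriangle_distinguished A X) hA hX⟩

end IsTriangulatedSubcat

section

open scoped ZeroObject

/-- Two objects are equivalent when they have the same complements with respect to `S`. -/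
def complementSetoid (S : Set C) : Setoid C where
  r U V := ∀ X : C, (U ⊞ X) ∈ S ↔ (V ⊞ X) ∈ S
  iseqv := ⟨fun _ _ => Iff.rfl, fun h X => (h X).symm, fun h h' X => (h X).trans (h' X)⟩

/-- The classes of objects of `C` modulo the dense triangulated subcategory `S`, as a group under
direct sum. -/
@[reducible]
noncomputable def complementAddCommGroup {S : Set C} (h : IsTriangulatedSubcat C S)
    (hd : DenseSub C S) : AddCommGroup (Quotient (complementSetoid S)) :=
  have mk_eq {U V : C} (e : U ≅ V) :
      (Quotient.mk (complementSetoid S) U) = Quotient.mk (complementSetoid S) V :=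
    Quotient.sound fun X => h.mem_iff_of_iso (biprod.mapIso e (Iso.refl X))
  letI : Add (Quotient (complementSetoid S)) :=
    ⟨Quotient.map₂ (· ⊞ ·) fun U U' hU V V' hV X => by
      rw [h.mem_iff_of_iso (biprod.associator U V X), hU (V ⊞ X),
        h.mem_iff_of_iso (biprod.mapIso (Iso.refl U') (biprod.braiding V X)),
        ← h.mem_iff_of_iso (biprod.associator U' X V),
        h.mem_iff_of_iso (biprod.braiding (U' ⊞ X) V), hV (U' ⊞ X),
        h.mem_iff_of_iso (biprod.braiding V' (U' ⊞ X)),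
        h.mem_iff_of_iso (biprod.associator U' X V'),
        h.mem_iff_of_iso (biprod.mapIso (Iso.refl U') (biprod.braiding X V')),
        ← h.mem_iff_of_iso (biprod.associator U' V' X)]⟩
  letI : Zero (Quotient (complementSetoid S)) := ⟨Quotient.mk _ (0 : C)⟩
  letI : Neg (Quotient (complementSetoid S)) := ⟨fun q => Quotient.mk _ (hd q.out).choose⟩
  { AddGroup.ofLeftAxioms (G := Quotient (complementSetoid S))
      (by
        rintro ⟨U⟩ ⟨V⟩ ⟨W⟩
        exact mk_eq (biprod.associator U V W))
      (by
        rintro ⟨U⟩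
        exact mk_eq (isoZeroBiprod (isZero_zero C)).symm)
      (fun q => by
        have hq := (hd q.out).choose_spec
        set V := (hd q.out).choose
        conv_lhs => arg 2; rw [← q.out_eq]
        refine Quotient.sound (s := complementSetoid S) (a := V ⊞ q.out) (b := (0 : C))
          fun X => ?_
        rw [h.biprod_mem_iff ((h.mem_iff_of_iso (biprod.braiding _ _)).1 hq),
          ← h.mem_iff_of_iso (isoZeroBiprod (isZero_zero C))]) with
    add_comm := by
      rintro ⟨U⟩ ⟨V⟩
      exact mk_eq (biprod.braiding U V) }

/-- A dense triangulated subcategory consists of the objects whose class is killed by some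
homomorphism out of the Grothendieck group. -/
theorem exists_hom_cls_eq_zero_iff {S : Set C} (h : IsTriangulatedSubcat C S)
    (hd : DenseSub C S) :
    ∃ (A : Type u) (_ : AddCommGroup A) (φ : G C →+ A), ∀ U : C, φ (cls C U) = 0 ↔ U ∈ S := by
  let _ := complementAddCommGroup h hd
  let m : C → Quotient (complementSetoid S) := Quotient.mk _
  have m_add (U V : C) : m (U ⊞ V) = m U + m V := rfl
  have m_zero (U : C) : m U = 0 ↔ U ∈ S := by
    have h0 : (0 : C) ∈ S := by
      obtain ⟨V, hV⟩ := hd 0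
      exact h.ext_mem _ (contractible_distinguished V) ((h.mem_iff_of_iso
        (isoZeroBiprod (isZero_zero C))).2 hV) ((h.mem_iff_of_iso
        (isoZeroBiprod (isZero_zero C))).2 hV)
    constructor
    · intro hU
      have := (Quotient.exact (s := complementSetoid S) (a := U) (b := (0 : C)) hU) 0
      rwa [h.biprod_mem_iff h0, iff_true_right h0,
        ← h.mem_iff_of_iso (isoBiprodZero (isZero_zero C))] at this
    · intro hU
      exact Quotient.sound (s := complementSetoid S) (a := U) (b := (0 : C)) fun X => by
        rw [h.biprod_mem_iff hU, h.biprod_mem_iff h0]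
  have m_obj₂ (T : Triangle C) (hT : T ∈ distTriang C) : m T.obj₂ = m T.obj₁ + m T.obj₃ := by
    obtain ⟨U', hU'⟩ := hd T.obj₁
    obtain ⟨W', hW'⟩ := hd T.obj₃
    obtain ⟨T', hT', ⟨e₁⟩, ⟨e₂⟩, ⟨e₃⟩⟩ :=
      exists_distTriang_biprod hT (binaryBiproductTriangle_distinguished U' W')
    have hV : (T.obj₂ ⊞ (U' ⊞ W')) ∈ S := h.mem_of_iso e₂
      (h.obj₂_mem hT' (h.mem_of_iso e₁.symm hU') (h.mem_of_iso e₃.symm hW'))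
    rw [← m_zero, m_add] at hU' hW' hV
    rw [m_add] at hV
    rw [eq_neg_of_add_eq_zero_left hU', eq_neg_of_add_eq_zero_left hW',
      eq_neg_of_add_eq_zero_left hV, neg_add]
  let φ : G C →+ Quotient (complementSetoid S) :=
    QuotientAddGroup.lift (eulerSubgroup C) (FreeAbelianGroup.lift m) (by
      rw [eulerSubgroup, AddSubgroup.closure_le]
      rintro x ⟨T, hT, rfl⟩
      simp [m_obj₂ T hT])
  refine ⟨_, _, φ, fun U => ?_⟩
  have : φ (cls C U) = m U := FreeAbelianGroup.lift_apply_of m U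
  rw [this, m_zero]

end

lemma tmul_cls_mem_range_deltaQ {S : Set C} {U : C} (hU : U ∈ S) :
    (1 : ℚ) ⊗ₜ[ℤ] cls C U ∈ LinearMap.range (deltaQ C S) :=
  ⟨1 ⊗ₜ (QuotientAddGroup.mk (FreeAbelianGroup.of ⟨U, hU⟩) : GSub C S), rfl⟩

lemma exists_nsmul_eq_zero_of_one_tmul_eq_zero {A : Type*} [AddCommGroup A] {a : A}
    (ha : (1 : ℚ) ⊗ₜ[ℤ] a = 0) : ∃ n : ℕ, 1 ≤ n ∧ n • a = 0 := by
  obtain ⟨c, hc⟩ := (IsLocalizedModule.eq_zero_iff (nonZeroDivisors ℤ)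
    (TensorProduct.mk ℤ ℚ A 1)).1 ha
  refine ⟨(c : ℤ).natAbs, Int.natAbs_pos.2 (nonZeroDivisors.coe_ne_zero c), ?_⟩
  rw [← natCast_zsmul]
  rcases Int.natAbs_eq (c : ℤ) with h | h
  · rw [← h]
    exact hc
  · rw [← neg_eq_iff_eq_neg.2 h, neg_zsmul, neg_eq_zero]
    exact hc

/-- A radical dense triangulated subcategory contains every object whose rational class lies in
its image. -/
theorem mem_of_tmul_cls_mem_range_deltaQ {S : Set C} (h : IsTriangulatedSubcat C S)
    (hd : DenseSub C S) (hr : RadicalSub C S) {U : C}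
    (hU : (1 : ℚ) ⊗ₜ[ℤ] cls C U ∈ LinearMap.range (deltaQ C S)) : U ∈ S := by
  obtain ⟨A, _, φ, hφ⟩ := exists_hom_cls_eq_zero_iff h hd
  have hcomp : φ.toIntLinearMap ∘ₗ (deltaHom C S).toIntLinearMap = 0 := by
    ext x
    obtain ⟨x, rfl⟩ := QuotientAddGroup.mk_surjective x
    change (φ.comp ((deltaHom C S).comp (QuotientAddGroup.mk' _))) x = (0 : _ →+ A) x
    congr 1
    ext V
    exact (hφ V).2 V.2
  obtain ⟨z, hz⟩ := hU
  have hzero : (1 : ℚ) ⊗ₜ[ℤ] φ (cls C U) = 0 := by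
    have := LinearMap.congr_fun (LinearMap.baseChange_comp (A := ℚ)
      (f := (deltaHom C S).toIntLinearMap) φ.toIntLinearMap) z
    rw [hcomp, LinearMap.baseChange_zero] at this
    change 0 = (φ.toIntLinearMap.baseChange ℚ) (deltaQ C S z) at this
    rw [hz] at this
    exact this.symm
  obtain ⟨n, hn, hnU⟩ := exists_nsmul_eq_zero_of_one_tmul_eq_zero hzero
  refine hr U n hn ((hφ _).1 ?_)
  rw [cls_npow U hn, map_nsmul, hnU]

/-- A radical dense triangulated subcategory is determined by the image of its rational
Grothendieck group. -/
theorem mem_iff_tmul_cls_mem_range_deltaQ {S : Set C} (h : IsTriangulatedSubcat C S)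
    (hd : DenseSub C S) (hr : RadicalSub C S) {U : C} :
    U ∈ S ↔ (1 : ℚ) ⊗ₜ[ℤ] cls C U ∈ LinearMap.range (deltaQ C S) :=
  ⟨tmul_cls_mem_range_deltaQ, mem_of_tmul_cls_mem_range_deltaQ h hd hr⟩

variable (C)

/-- two radical dense subcategories with the same image in `G(C)_ℚ`
coincide; thus there is a unique radical dense subcategory `D_H` with
`image δ^{D_H}_ℚ = H`. -/
theorem radical_dense_subcategory_unique (H : Submodule ℚ (ℚ ⊗[ℤ] G C)) (S₁ S₂ : Set C)
    (h₁ : IsTriangulatedSubcat C S₁) (hd₁ : DenseSub C S₁) (hr₁ : RadicalSub C S₁)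
    (h₂ : IsTriangulatedSubcat C S₂) (hd₂ : DenseSub C S₂) (hr₂ : RadicalSub C S₂)
    (hH₁ : LinearMap.range (deltaQ C S₁) = H) (hH₂ : LinearMap.range (deltaQ C S₂) = H) :
    S₁ = S₂ ∧
    ∃! S : Set C, IsTriangulatedSubcat C S ∧ DenseSub C S ∧ RadicalSub C S ∧
      LinearMap.range (deltaQ C S) = H := by
  have key {S S' : Set C} (h : IsTriangulatedSubcat C S) (hd : DenseSub C S)
      (hr : RadicalSub C S) (h' : IsTriangulatedSubcat C S') (hd' : DenseSub C S')
      (hr' : RadicalSub C S')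
      (hH : LinearMap.range (deltaQ C S) = LinearMap.range (deltaQ C S')) : S = S' := by
    ext U
    rw [mem_iff_tmul_cls_mem_range_deltaQ h hd hr, mem_iff_tmul_cls_mem_range_deltaQ h' hd' hr', hH]
  exact ⟨key h₁ hd₁ hr₁ h₂ hd₂ hr₂ (hH₁.trans hH₂.symm), S₁, ⟨h₁, hd₁, hr₁, hH₁⟩,
    fun S ⟨h, hd, hr, hH⟩ => key h hd hr h₁ hd₁ hr₁ (hH.trans hH₁.symm)⟩


end GrothendieckPaper
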